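/- arXiv:2601.03176 — 8 statements merged into one kernel-verified Lean document; each statement's English description precedes it below -/
import Mathlib

section
/- Let Ω be a set and (f_l)_{l∈I} a locally finite family of functions Ω → ℚ, and let U := {α ∈ ℚ[Ω] : ⟨f_l, α⟩ = 0 for all l ∈ I}. Then every relation f ∈ U^⊥ can be written as a (possibly infinite, pointwise finite) linear combination of the f_l: there exists λ : I → ℚ such that for every x ∈ Ω one has f(x) = Σ_{l ∈ I, f_l(x) ≠ 0} λ(l)·f_l(x). -/
/-- If `(f l)` is a locally finite family of functions `Ω → ℚ`,
`U := {α ∈ ℚ[Ω] | ⟨f l, α⟩ = 0 ∀ l}`, then every relation `g ∈ U^⊥` is a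
(pointwise finite) linear combination of the `f l`. -/
theorem stmt_0 {Ω I : Type*} (f : I → Ω → ℚ)
    (hlf : ∀ x : Ω, {l : I | f l x ≠ 0}.Finite)
    (g : Ω → ℚ)
    (hg : ∀ α : Ω →₀ ℚ,
      (∀ l : I, (α.sum fun x a => f l x * a) = 0) →
      (α.sum fun x a => g x * a) = 0) :
    ∃ lam : I → ℚ, ∀ x : Ω,
      g x = ∑ l ∈ (hlf x).toFinset, lam l * f l x := by
  classical
  let v : Ω → I →₀ ℚ := fun x => Finsupp.onFinset (hlf x).toFinset (fun l => f l x)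
    (fun l hl => by simpa using hl)
  let T : (Ω →₀ ℚ) →ₗ[ℚ] (I →₀ ℚ) := Finsupp.linearCombination ℚ v
  let G : Module.Dual ℚ (Ω →₀ ℚ) := Finsupp.linearCombination ℚ g
  have hG : G ∈ LinearMap.range T.dualMap := by
    rw [LinearMap.range_dualMap_eq_dualAnnihilator_ker, Submodule.mem_dualAnnihilator]
    intro α hα
    have h := hg α fun l => by
      have hl := DFunLike.congr_fun (LinearMap.mem_ker.mp hα) l
      simpa [T, v, Finsupp.linearCombination_apply, Finsupp.sum, Finsupp.finsetSum_apply,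
        mul_comm] using hl
    simpa [G, Finsupp.linearCombination_apply, Finsupp.sum, mul_comm] using h
  obtain ⟨φ, hφ⟩ := hG
  refine ⟨fun l => φ (Finsupp.single l 1), fun x => ?_⟩
  have hx : φ (v x) = g x := by
    simpa [T, G] using LinearMap.congr_fun hφ (Finsupp.single x 1)
  have hv : v x = ∑ l ∈ (hlf x).toFinset, f l x • Finsupp.single l (1 : ℚ) := by
    ext l
    by_cases hl : f l x = 0 <;>
      simp [v, Finsupp.finsetSum_apply, Finsupp.single_apply, hl]
  rw [← hx, hv, map_sum]
  simp only [map_smul, smul_eq_mul, mul_comm]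
end

section
/- Let Ω be a set and S a finitely consistent family of finite affine functionals on ℚ^Ω. Then S is consistent: there exists g : Ω → ℚ such that ξ(g) = 0 for every ξ ∈ S. -/
/-- A linear system `Φ (α i) = b i` for an unknown functional `Φ` is solvable as soon as each of
its finite subsystems is. -/
theorem exists_dual_eq_of_finite {K V ι : Type*} [Field K] [AddCommGroup V] [Module K V]
    (α : ι → V) (b : ι → K)
    (h : ∀ s : Finset ι, ∃ Φ : Module.Dual K V, ∀ i ∈ s, Φ (α i) = b i) :
    ∃ Φ : Module.Dual K V, ∀ i, Φ (α i) = b i := by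
  have hB : Finsupp.linearCombination K b ∈
      LinearMap.range (Finsupp.linearCombination K α).dualMap := by
    rw [LinearMap.range_dualMap_eq_dualAnnihilator_ker, Submodule.mem_dualAnnihilator]
    intro v hv
    obtain ⟨Φ, hΦ⟩ := h v.support
    rw [LinearMap.mem_ker, Finsupp.linearCombination_apply] at hv
    have hv' := congrArg Φ hv
    rw [map_zero, Finsupp.sum, map_sum] at hv'
    rw [Finsupp.linearCombination_apply, Finsupp.sum, ← hv']
    refine Finset.sum_congr rfl fun i hi => ?_
    rw [map_smul, hΦ i hi]
  obtain ⟨Φ, hΦ⟩ := hB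
  refine ⟨Φ, fun i => ?_⟩
  simpa using LinearMap.congr_fun hΦ (Finsupp.single i 1)

/-- A finitely consistent family of finite affine functionals on
`ℚ^Ω` is consistent. -/
theorem stmt_2 {Ω : Type*} (S : Set ((Ω → ℚ) → ℚ))
    (haff : ∀ ξ ∈ S, ∃ (α : Ω →₀ ℚ) (b : ℚ),
      ∀ f : Ω → ℚ, ξ f = (α.sum fun x a => f x * a) + b)
    (hfin : ∀ T : Set ((Ω → ℚ) → ℚ), T ⊆ S → T.Finite →
      ∃ f : Ω → ℚ, ∀ ξ ∈ T, ξ f = 0) :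
    ∃ g : Ω → ℚ, ∀ ξ ∈ S, ξ g = 0 := by
  choose α b hαb using fun ξ : S => haff ξ ξ.2
  obtain ⟨Φ, hΦ⟩ := exists_dual_eq_of_finite α (fun ξ => -b ξ) fun s => by
    obtain ⟨f, hf⟩ := hfin (Set.image Subtype.val (s : Set S)) (by rintro _ ⟨ξ, -, rfl⟩; exact ξ.2)
      (s.finite_toSet.image _)
    refine ⟨Finsupp.linearCombination ℚ f, fun ξ hξ => ?_⟩
    have h := hf ξ ⟨ξ, hξ, rfl⟩
    rw [hαb] at h
    simpa [Finsupp.linearCombination_apply, mul_comm] using eq_neg_of_add_eq_zero_left h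
  refine ⟨fun x => Φ (Finsupp.single x 1), fun ξ hξ => ?_⟩
  have h : Φ = Finsupp.linearCombination ℚ fun x => Φ (Finsupp.single x 1) := by
    ext x
    simp
  have hξΦ := hΦ ⟨ξ, hξ⟩
  rw [h, Finsupp.linearCombination_apply] at hξΦ
  refine (hαb ⟨ξ, hξ⟩ _).trans ?_
  rw [← eq_neg_iff_add_eq_zero, ← hξΦ]
  simp only [smul_eq_mul, mul_comm]
end

section
/- Let Ω be a set, S a finitely consistent family of finite affine functionals on ℚ^Ω, and x ∈ Ω. Then there exists q ∈ ℚ such that the enlarged family S ∪ {f ↦ f(x) − q} is still finitely consistent. -/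
/-- A finite affine functional commutes with affine combinations of two functions. -/
theorem finite_affine_map_lineMap {Ω : Type*} {ξ : (Ω → ℚ) → ℚ} {α : Ω →₀ ℚ} {b : ℚ}
    (hξ : ∀ f : Ω → ℚ, ξ f = (α.sum fun x a => f x * a) + b) (f g : Ω → ℚ) (t : ℚ) :
    ξ (fun y => (1 - t) * f y + t * g y) = (1 - t) * ξ f + t * ξ g := by
  have h : (α.sum fun y a => ((1 - t) * f y + t * g y) * a) =
      (1 - t) * (α.sum fun y a => f y * a) + t * (α.sum fun y a => g y * a) := by
    simp only [Finsupp.sum, Finset.mul_sum, ← Finset.sum_add_distrib]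
    exact Finset.sum_congr rfl fun y _ => by ring
  rw [hξ, hξ f, hξ g, h]
  ring


/-- A finitely consistent family of finite affine functionals on
`ℚ^Ω` can be enlarged by a functional of the form `f ↦ f x - q` while staying
finitely consistent. -/
theorem stmt_3 {Ω : Type*} (S : Set ((Ω → ℚ) → ℚ))
    (haff : ∀ ξ ∈ S, ∃ (α : Ω →₀ ℚ) (b : ℚ),
      ∀ f : Ω → ℚ, ξ f = (α.sum fun x a => f x * a) + b)
    (hfin : ∀ T : Set ((Ω → ℚ) → ℚ), T ⊆ S → T.Finite →
      ∃ f : Ω → ℚ, ∀ ξ ∈ T, ξ f = 0)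
    (x : Ω) :
    ∃ q : ℚ, ∀ T : Set ((Ω → ℚ) → ℚ),
      T ⊆ S ∪ {fun f => f x - q} → T.Finite →
      ∃ f : Ω → ℚ, ∀ ξ ∈ T, ξ f = 0 := by
  by_cases hx : ∃ T₀ ⊆ S, T₀.Finite ∧ ∃ q : ℚ, ∀ f : Ω → ℚ, (∀ ξ ∈ T₀, ξ f = 0) → f x = q
  · obtain ⟨T₀, hT₀, hT₀fin, q, hq⟩ := hx
    refine ⟨q, fun T hT hTfin => ?_⟩
    obtain ⟨f, hf⟩ := hfin (T ∩ S ∪ T₀) (Set.union_subset Set.inter_subset_right hT₀)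
      ((hTfin.subset Set.inter_subset_left).union hT₀fin)
    refine ⟨f, fun ξ hξ => ?_⟩
    rcases hT hξ with hS | rfl
    · exact hf ξ (Or.inl ⟨hξ, hS⟩)
    · exact sub_eq_zero.2 (hq f fun η hη => hf η (Or.inr hη))
  · push Not at hx
    refine ⟨0, fun T hT hTfin => ?_⟩
    have hTS : (T ∩ S).Finite := hTfin.subset Set.inter_subset_left
    obtain ⟨f, hf⟩ := hfin (T ∩ S) Set.inter_subset_right hTS
    obtain ⟨g, hg, hgf⟩ := hx (T ∩ S) Set.inter_subset_right hTS (f x)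
    have hne : g x - f x ≠ 0 := sub_ne_zero.2 hgf
    refine ⟨fun y => (1 - -f x / (g x - f x)) * f y + -f x / (g x - f x) * g y, fun ξ hξ => ?_⟩
    rcases hT hξ with hS | rfl
    · obtain ⟨α, b, hαb⟩ := haff ξ hS
      rw [finite_affine_map_lineMap hαb, hf ξ ⟨hξ, hS⟩, hg ξ ⟨hξ, hS⟩]
      ring
    · field_simp
      ring
end

section
/- Let Λ be a finite set, M and N vector spaces over ℚ, T : M → N a ℚ-linear map, and R a set of coefficient functions c : Λ → ℚ. Suppose v : Λ → N is such that every v(λ) lies in the range of T and v satisfies all relations of R, i.e. Σ_{λ∈Λ} c(λ)·v(λ) = 0 in N for every c ∈ R. Then there exists u : Λ → M such that T(u(λ)) = v(λ) for every λ ∈ Λ and u satisfies the same relations: Σ_{λ∈Λ} c(λ)·u(λ) = 0 in M for every c ∈ R. -/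
/-- A tuple `v : Λ → N` of vectors in the range of a linear map
`T : M → N` that satisfies a given set of `Λ`-relations lifts to a tuple
`u : Λ → M` satisfying the same `Λ`-relations with `T ∘ u = v`. -/
theorem stmt_5 {Λ : Type*} [Fintype Λ]
    {M N : Type*} [AddCommGroup M] [Module ℚ M] [AddCommGroup N] [Module ℚ N]
    (T : M →ₗ[ℚ] N) (R : Set (Λ → ℚ)) (v : Λ → N)
    (hv : ∀ l : Λ, v l ∈ Set.range T)
    (hrel : ∀ c ∈ R, ∑ l : Λ, c l • v l = 0) :
    ∃ u : Λ → M, (∀ l : Λ, T (u l) = v l) ∧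
      ∀ c ∈ R, ∑ l : Λ, c l • u l = 0 := by
  obtain ⟨S, hS⟩ := T.rangeRestrict.exists_rightInverse_of_surjective T.range_rangeRestrict
  let w : Λ → LinearMap.range T := fun l => ⟨v l, hv l⟩
  refine ⟨fun l => S (w l), fun l => congrArg Subtype.val (LinearMap.congr_fun hS (w l)),
    fun c hc => ?_⟩
  have hw : ∑ l, c l • w l = 0 := Subtype.ext (by simpa [w] using hrel c hc)
  simpa using congrArg S hw
end

section
/- Let A ⊆ ℝ be a ℚ-linear subspace of ℝ and let μ be a simple valuation on A-intervals that is A-invariant, i.e. μ(a+t, b+t) = μ(a,b) for all a ≤ b in A and all t ∈ A. Then there is a unique function f : A → ℚ with f(0) = 0 and μ(a,b) = f(b) − f(a) for all a ≤ b in A, and this f is ℚ-linear: f(a+b) = f(a) + f(b) and f(q·a) = q·f(a) for all a, b ∈ A and all q ∈ ℚ. -/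
/-- For a `ℚ`-linear subspace `A ⊆ ℝ` and an `A`-invariant simple
valuation `μ` on `A`-intervals, there is a unique `f : A → ℚ` with `f 0 = 0`
and `μ a b = f b - f a` for `a ≤ b` in `A`, and this `f` is `ℚ`-linear. -/
theorem stmt_8 (A : Submodule ℚ ℝ) (μ : ℝ → ℝ → ℚ)
    (hzero : ∀ a ∈ A, μ a a = 0)
    (hadd : ∀ a ∈ A, ∀ b ∈ A, ∀ c ∈ A, a ≤ b → b ≤ c →
      μ a c = μ a b + μ b c)
    (hinv : ∀ a ∈ A, ∀ b ∈ A, ∀ t ∈ A, a ≤ b → μ (a + t) (b + t) = μ a b) :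
    (∃! f : A → ℚ, f 0 = 0 ∧
        ∀ a b : A, (a : ℝ) ≤ (b : ℝ) → μ a b = f b - f a) ∧
      ∀ f : A → ℚ, (f 0 = 0 ∧
          ∀ a b : A, (a : ℝ) ≤ (b : ℝ) → μ a b = f b - f a) →
        (∀ a b : A, f (a + b) = f a + f b) ∧
          ∀ (q : ℚ) (a : A), f (q • a) = q * f a := by
  refine ⟨⟨fun a => if (0 : ℝ) ≤ a then μ 0 a else -μ a 0, ⟨?_, ?_⟩, ?_⟩, ?_⟩
  · simp [hzero 0 A.zero_mem]
  · intro a b hab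
    have h0 := A.zero_mem
    dsimp only
    split_ifs with hb ha ha
    · linarith [hadd 0 h0 a a.2 b b.2 ha hab]
    · linarith [hadd a a.2 0 h0 b b.2 (not_le.mp ha).le hb]
    · exact absurd (ha.trans hab) hb
    · linarith [hadd a a.2 b b.2 0 h0 hab (not_le.mp hb).le]
  · rintro g ⟨hg0, hg⟩
    funext a
    split_ifs with ha
    · have := hg 0 a ha
      rw [hg0, sub_zero] at this
      exact this.symm
    · have := hg a 0 (not_le.mp ha).le
      rw [hg0, zero_sub] at this
      exact neg_eq_iff_eq_neg.mp this.symm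
  · rintro f ⟨hf0, hf⟩
    have map_add (a b : A) : f (a + b) = f a + f b := by
      rcases le_total (0 : ℝ) b with hb | hb
      · have hμ := hinv 0 A.zero_mem b b.2 a a.2 hb
        rw [zero_add, ← A.coe_add, hf a (b + a) (by simpa using hb), ← A.coe_zero,
          hf 0 b hb, add_comm b a] at hμ
        linarith
      · have hμ := hinv b b.2 0 A.zero_mem a a.2 hb
        rw [zero_add, ← A.coe_add, hf (b + a) a (by simpa using hb), ← A.coe_zero,
          hf b 0 hb, add_comm b a] at hμ
        linarith
    exact ⟨map_add, fun q a => map_rat_smul (AddMonoidHom.mk' f map_add) q a⟩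
end

section
/- Let A ⊆ ℚ be nonempty with A + 1 = A (i.e. a ∈ A if and only if a + 1 ∈ A), and let μ be a ℤ-invariant simple valuation on A-intervals, i.e. μ(a+1, b+1) = μ(a,b) for all a ≤ b in A. Then there exist c ∈ ℚ and a 1-periodic function f : A → ℚ (meaning f(a+1) = f(a) for all a ∈ A) such that μ(a,b) = c·(b−a) + f(b) − f(a) for all a ≤ b in A. -/
/-- Every `ℤ`-invariant simple valuation on intervals with
endpoints in a `ℤ`-stable set `A ⊆ ℚ` is a combination of the length and a
`1`-periodic function on `A`. -/
theorem stmt_9 (A : Set ℚ) (hA : A.Nonempty)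
    (hstab : ∀ a : ℚ, a ∈ A ↔ a + 1 ∈ A)
    (μ : ℚ → ℚ → ℚ)
    (hzero : ∀ a ∈ A, μ a a = 0)
    (hadd : ∀ a ∈ A, ∀ b ∈ A, ∀ c ∈ A, a ≤ b → b ≤ c →
      μ a c = μ a b + μ b c)
    (hinv : ∀ a ∈ A, ∀ b ∈ A, a ≤ b → μ (a + 1) (b + 1) = μ a b) :
    ∃ (c : ℚ) (f : ℚ → ℚ), (∀ a ∈ A, f (a + 1) = f a) ∧
      ∀ a ∈ A, ∀ b ∈ A, a ≤ b → μ a b = c * (b - a) + f b - f a := by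
  have hunit : ∀ x ∈ A, ∀ y ∈ A, x ≤ y → μ x (x + 1) = μ y (y + 1) := by
    intro x hx y hy hxy
    have hx' := (hstab x).1 hx
    have hy' := (hstab y).1 hy
    have h₁ := hadd x hx y hy (y + 1) hy' hxy (by linarith)
    have h₂ := hadd x hx (x + 1) hx' (y + 1) hy' (by linarith) (by linarith)
    have h₃ := hinv x hx y hy hxy
    linarith
  obtain ⟨a₀, ha₀⟩ := hA
  obtain ⟨g, hg⟩ : ∃ g : ℚ → ℚ, ∀ a ∈ A, ∀ b ∈ A, a ≤ b → μ a b = g b - g a := by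
    refine ⟨fun x => if a₀ ≤ x then μ a₀ x else -μ x a₀, fun a ha b hb hab => ?_⟩
    by_cases h₁ : a₀ ≤ a
    · have h₂ : a₀ ≤ b := h₁.trans hab
      simp only [h₁, h₂, if_true]
      linarith [hadd a₀ ha₀ a ha b hb h₁ hab]
    · by_cases h₂ : a₀ ≤ b
      · simp only [h₁, h₂, if_true, if_false]
        linarith [hadd a ha a₀ ha₀ b hb (le_of_not_ge h₁) h₂]
      · simp only [h₁, h₂, if_false]
        linarith [hadd a ha b hb a₀ ha₀ hab (le_of_not_ge h₂)]
  refine ⟨μ a₀ (a₀ + 1), fun x => g x - μ a₀ (a₀ + 1) * x, fun a ha => ?_,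
    fun a ha b hb hab => ?_⟩
  · have h₁ := hg a ha (a + 1) ((hstab a).1 ha) (by linarith)
    have h₂ : μ a (a + 1) = μ a₀ (a₀ + 1) :=
      (le_total a a₀).elim (hunit a ha a₀ ha₀) fun h => (hunit a₀ ha₀ a ha h).symm
    linarith
  · rw [hg a ha b hb hab]
    ring
end

section
/- Let P₁, P₂, Q be nonempty compact convex subsets of ℝ^n such that P₁ ∪ P₂ is convex. Then vol(P₁ + Q) + vol(P₂ + Q) = vol((P₁ ∪ P₂) + Q) + vol((P₁ ∩ P₂) + Q), where + denotes the Minkowski sum of subsets of ℝ^n and vol denotes the Lebesgue measure on ℝ^n. In other words, for fixed Q, the map P ↦ vol(P + Q) satisfies the valuation property on convex bodies whose union is convex. -/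
open Pointwise MeasureTheory

/-- If two closed sets have convex union, then every segment joining them meets their
intersection. -/
theorem Convex.exists_mem_segment_inter_of_union {E : Type*} [AddCommGroup E] [Module ℝ E]
    [TopologicalSpace E] [ContinuousAdd E] [ContinuousSMul ℝ E] {s t : Set E}
    (h : Convex ℝ (s ∪ t)) (hs : IsClosed s) (ht : IsClosed t) {x y : E} (hx : x ∈ s)
    (hy : y ∈ t) : ∃ z ∈ segment ℝ x y, z ∈ s ∩ t :=
  isPreconnected_closed_iff.1 (convex_segment x y).isPreconnected s t hs ht
    (h.segment_subset (Or.inl hx) (Or.inr hy))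
    ⟨x, left_mem_segment ℝ x y, hx⟩ ⟨y, right_mem_segment ℝ x y, hy⟩

/-- Minkowski addition of a convex set distributes over the intersection of two closed sets
with convex union. -/
theorem Convex.inter_add_of_union {E : Type*} [AddCommGroup E] [Module ℝ E]
    [TopologicalSpace E] [ContinuousAdd E] [ContinuousSMul ℝ E] {s t u : Set E}
    (h : Convex ℝ (s ∪ t)) (hs : IsClosed s) (ht : IsClosed t) (hu : Convex ℝ u) :
    s ∩ t + u = (s + u) ∩ (t + u) := by
  refine Set.inter_add_subset.antisymm ?_
  rintro _ ⟨⟨x, hx, v, hv, rfl⟩, ⟨y, hy, w, hw, hxy⟩⟩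
  obtain ⟨z, ⟨a, b, ha, hb, hab, rfl⟩, hz⟩ := h.exists_mem_segment_inter_of_union hs ht hx hy
  refine ⟨_, hz, _, hu hv hw ha hb hab, ?_⟩
  dsimp only at hxy ⊢
  calc a • x + b • y + (a • v + b • w) = a • (x + v) + b • (y + w) := by module
    _ = x + v := by rw [hxy, Convex.combo_self hab]

/-- For nonempty compact convex `P₁, P₂ ⊆ ℝⁿ` with `P₁ ∪ P₂`
convex and a fixed `Q`, the map `P ↦ vol (P + Q)` satisfies the valuation
property. -/
theorem stmt_10 (n : ℕ) (P₁ P₂ Q : Set (Fin n → ℝ))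
    (hP₁ : P₁.Nonempty) (hP₂ : P₂.Nonempty) (hQ : Q.Nonempty)
    (hcP₁ : IsCompact P₁) (hcP₂ : IsCompact P₂) (hcQ : IsCompact Q)
    (hvP₁ : Convex ℝ P₁) (hvP₂ : Convex ℝ P₂) (hvQ : Convex ℝ Q)
    (hvU : Convex ℝ (P₁ ∪ P₂)) :
    volume (P₁ + Q) + volume (P₂ + Q) =
      volume ((P₁ ∪ P₂) + Q) + volume ((P₁ ∩ P₂) + Q) := by
  rw [Set.union_add, hvU.inter_add_of_union hcP₁.isClosed hcP₂.isClosed hvQ,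
    measure_union_add_inter _ (hcP₂.add hcQ).measurableSet]
end

section
/- Let P₁, P₂ be closed convex subsets of ℝ^n such that P₁ ∪ P₂ is convex, and let Q ⊆ ℝ^n be convex. Then (P₁ ∩ P₂) + Q = (P₁ + Q) ∩ (P₂ + Q), where + denotes the Minkowski sum. -/
open Pointwise

/-- If `P₁, P₂ ⊆ ℝⁿ` are closed convex sets with `P₁ ∪ P₂`
convex and `Q` is convex, then `(P₁ ∩ P₂) + Q = (P₁ + Q) ∩ (P₂ + Q)`. -/
theorem stmt_11 (n : ℕ) (P₁ P₂ Q : Set (Fin n → ℝ))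
    (hclP₁ : IsClosed P₁) (hclP₂ : IsClosed P₂)
    (hvP₁ : Convex ℝ P₁) (hvP₂ : Convex ℝ P₂)
    (hvU : Convex ℝ (P₁ ∪ P₂)) (hvQ : Convex ℝ Q) :
    (P₁ ∩ P₂) + Q = (P₁ + Q) ∩ (P₂ + Q) := by
  refine Set.Subset.antisymm Set.inter_add_subset ?_
  rintro x ⟨⟨p₁, hp₁, q₁, hq₁, h₁⟩, ⟨p₂, hp₂, q₂, hq₂, h₂⟩⟩
  obtain ⟨p, ⟨a, b, ha, hb, hab, rfl⟩, hp⟩ :=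
    isPreconnected_closed_iff.1 (convex_segment (𝕜 := ℝ) p₁ p₂).isPreconnected P₁ P₂ hclP₁ hclP₂
      (hvU.segment_subset (Or.inl hp₁) (Or.inr hp₂))
      ⟨p₁, left_mem_segment ℝ p₁ p₂, hp₁⟩ ⟨p₂, right_mem_segment ℝ p₁ p₂, hp₂⟩
  refine ⟨_, hp, a • q₁ + b • q₂, hvQ hq₁ hq₂ ha hb hab, ?_⟩
  calc a • p₁ + b • p₂ + (a • q₁ + b • q₂) = a • (p₁ + q₁) + b • (p₂ + q₂) := by module
    _ = a • x + b • x := congrArg₂ (fun y z => a • y + b • z) h₁ h₂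
    _ = x := Convex.combo_self hab x
end
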